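/- (Erdős–Hajnal) For any infinite cardinal λ, there exists a function that is ω-Jónsson for λ: a function f : [λ]^ω → λ such that for every y ⊆ λ with |y| = λ, the image f''[y]^ω equals all of λ. -/

import Mathlib

universe u

/-- Two sequences are tail equivalent when they agree after deleting finite initial segments. -/
def tailSetoid (α : Type u) : Setoid (ℕ → α) where
  r s t := ∃ m n, ∀ k, s (m + k) = t (n + k)
  iseqv :=
    { refl := fun _ => ⟨0, 0, fun _ => rfl⟩
      symm := fun ⟨m, n, h⟩ => ⟨n, m, fun k => (h k).symm⟩
      trans := by
        rintro s t v ⟨m, n, h⟩ ⟨p, q, h'⟩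
        refine ⟨m + p, q + n, fun k => ?_⟩
        rw [add_assoc, h, add_assoc, ← h']
        congr 1
        omega }

/-- A set function recovering, from some tail of any strictly increasing sequence `s`, the term
of `s` preceding that tail. -/
theorem exists_recover_of_tail (α : Type u) [LinearOrder α] [Nonempty α] :
    ∃ g : Set α → α, ∀ s : ℕ → α, StrictMono s →
      ∃ m, g (Set.range fun k => s (m + 1 + k)) = s m := by
  let rep : (ℕ → α) → ℕ → α := fun s => (Quotient.mk (tailSetoid α) s).out
  have hrep (s : ℕ → α) : ∃ m n, ∀ k, rep s (m + k) = s (n + k) :=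
    Quotient.exact (s := tailSetoid α) (Quotient.out_eq (s := tailSetoid α) _)
  have hshift (s : ℕ → α) (p : ℕ) : rep (fun k => s (p + k)) = rep s := by
    refine congrArg Quotient.out (Quotient.sound (s := tailSetoid α) ⟨0, p, fun k => ?_⟩)
    simp
  let P : Set α → α → Prop := fun x a => ∃ t : ℕ → α, StrictMono t ∧ Set.range t = x ∧
    ∃ n, (∀ k, t k = rep t (n + 1 + k)) ∧ a = rep t n
  refine ⟨fun x => Classical.epsilon (P x), fun s hs => ?_⟩
  obtain ⟨n, m, h⟩ := hrep s
  refine ⟨m, ?_⟩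
  have htail : StrictMono fun k => s (m + 1 + k) := fun a b hab => hs (by omega)
  have hagree (k : ℕ) : s (m + 1 + k) = rep s (n + 1 + k) := by
    rw [add_assoc, add_assoc, h]
  have hP : P (Set.range fun k => s (m + 1 + k)) (s m) := by
    refine ⟨_, htail, rfl, n, fun k => ?_, ?_⟩
    · rw [hshift, hagree]
    · rw [hshift]
      simpa using (h 0).symm
  obtain ⟨t, ht, hrange, n', htn', hval⟩ := Classical.epsilon_spec (p := P _) ⟨_, hP⟩
  have htm : t = fun k => s (m + 1 + k) :=
    (StrictMono.range_inj ht htail).1 hrange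
  have hn : n' = n := by
    rw [htm, hshift] at htn'
    have key (k : ℕ) : rep s (n' + 1 + k) = rep s (n + 1 + k) := by
      rw [← htn', ← hagree]
    have hinj {i j : ℕ} (hij : rep s (n + i) = rep s (n + j)) : i = j := by
      rw [h, h] at hij
      have := hs.injective hij
      omega
    rcases le_total n n' with hle | hle
    · have := @hinj (n' - n + 1) 1 (by
        convert key 0 using 2
        omega)
      omega
    · have := @hinj 1 (n - n' + 1) (by
        convert key (n - n') using 2 <;> omega)
      omega
  beta_reduce
  rw [hval, htm, hshift, hn]
  simpa using h 0

/-- On an infinite type there are a set function `g` and a full-sized set `A` such that `g` attains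
every element of `A` on the countably infinite subsets of each full-sized subset of `A`. -/
theorem exists_jonsson_on_subset (α : Type u) [Infinite α] :
    ∃ (g : Set α → α) (A : Set α), Cardinal.mk A = Cardinal.mk α ∧
      ∀ y ⊆ A, Cardinal.mk y = Cardinal.mk α →
        ∀ a ∈ A, ∃ s ⊆ y, Cardinal.mk s = Cardinal.aleph0 ∧ g s = a := by
  obtain ⟨_, _, hord⟩ := Cardinal.exists_ord_eq_type_lt α
  obtain ⟨g, hg⟩ := exists_recover_of_tail α
  by_contra! hcon
  have hstep (A : {A : Set α // Cardinal.mk A = Cardinal.mk α}) :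
      ∃ (B : {A : Set α // Cardinal.mk A = Cardinal.mk α}) (a : α), B.1 ⊆ A.1 ∧ a ∈ A.1 ∧
        (∀ b ∈ B.1, a < b) ∧ ∀ s ⊆ B.1, Cardinal.mk s = Cardinal.aleph0 → g s ≠ a := by
    obtain ⟨y, hyA, hy, a, ha, hbad⟩ := hcon g A.1 A.2
    refine ⟨⟨y ∩ Set.Ioi a, ?_⟩, a, Set.inter_subset_left.trans hyA, ha, fun b hb => hb.2,
      fun s hs => hbad s (hs.trans Set.inter_subset_left)⟩
    refine le_antisymm (Cardinal.mk_set_le _) (le_of_not_gt fun hlt => ?_)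
    have hsub : y ⊆ (y ∩ Set.Ioi a) ∪ Set.Iic a := fun b hb =>
      (lt_or_ge a b).imp (fun h => ⟨hb, h⟩) id
    have hle := (Cardinal.mk_le_mk_of_subset hsub).trans (Cardinal.mk_union_le _ _)
    rw [hy] at hle
    exact hle.not_gt (Cardinal.add_lt_of_lt (Cardinal.aleph0_le_mk α) hlt
      (Cardinal.mk_Iic_lt a hord (Cardinal.aleph0_le_mk α)))
  choose next pt hsub hpt hlt hbad using hstep
  let A : ℕ → {A : Set α // Cardinal.mk A = Cardinal.mk α} :=
    fun n => next^[n] ⟨Set.univ, Cardinal.mk_univ⟩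
  have hA (n : ℕ) : A (n + 1) = next (A n) := Function.iterate_succ_apply' _ _ _
  have hanti : Antitone fun n => (A n).1 := antitone_nat_of_succ_le fun n => by
    rw [hA]
    exact hsub _
  have hs : StrictMono fun n => pt (A n) := strictMono_nat_of_lt_succ fun n =>
    hlt _ _ (hA n ▸ hpt (A (n + 1)))
  obtain ⟨m, hm⟩ := hg _ hs
  refine hbad (A m) _ ?_ ?_ hm
  · rintro _ ⟨k, rfl⟩
    rw [← hA]
    exact hanti (Nat.le_add_right _ _) (hpt _)
  · have hinj : Function.Injective fun k => pt (A (m + 1 + k)) :=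
      hs.injective.comp (add_right_injective _)
    have := Cardinal.mk_range_eq_of_injective hinj
    simpa using this

/-- **Erdős–Hajnal**: for any infinite cardinal `λ` (the cardinality of an infinite set `α`),
there is a function `f` that is `ω`-Jónsson for `λ`: `f` maps the countably infinite subsets
of `α` to `α`, and for every `y ⊆ α` of full cardinality, the image of `f` on the countably
infinite subsets of `y` is all of `α`. -/
theorem erdos_hajnal_omega_jonsson {α : Type u} [Infinite α] :
    ∃ f : {s : Set α // Cardinal.mk s = Cardinal.aleph0} → α,
      ∀ y : Set α, Cardinal.mk y = Cardinal.mk α →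
        f '' {s : {s : Set α // Cardinal.mk s = Cardinal.aleph0} | (s : Set α) ⊆ y} =
          Set.univ := by
  obtain ⟨g, A, hA, hg⟩ := exists_jonsson_on_subset α
  obtain ⟨e⟩ := Cardinal.eq.1 hA
  let i : α → α := fun a => e.symm a
  have hi : Function.Injective i := Subtype.val_injective.comp e.symm.injective
  refine ⟨fun s => Function.invFun i (g (i '' s.1)), fun y hy => ?_⟩
  refine Set.eq_univ_of_forall fun a => ?_
  obtain ⟨s, hsy, hs, hgs⟩ := hg (i '' y) (by rintro _ ⟨b, -, rfl⟩; exact (e.symm b).2)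
    ((Cardinal.mk_image_eq hi).trans hy) (i a) (e.symm a).2
  obtain ⟨t, hty, rfl⟩ := Set.subset_image_iff.1 hsy
  refine ⟨⟨t, (Cardinal.mk_image_eq hi).symm.trans hs⟩, hty, ?_⟩
  simp only [hgs]
  exact Function.leftInverse_invFun hi a
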